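/- For every x ∈ M_{m,n}(ℂ) there is a unique w ∈ S_N such that x ∈ P_w, and this w satisfies w ≥ (w∘ⁿ,w∘ᵐ) in the Bruhat order. Conversely, for every w ∈ S_N with w ≥ (w∘ⁿ,w∘ᵐ), the set P_w is nonempty. Hence M_{m,n}(ℂ) is the disjoint union of the sets P_w over all w ∈ S_N with w ≥ (w∘ⁿ,w∘ᵐ). -/

import Mathlib

open Matrix

noncomputable section

abbrev Mat (k l : ℕ) := Matrix (Fin k) (Fin l) ℂ

/-- permutation matrix: (i,j) entry is 1 exactly when i = w j -/
def permMat (k : ℕ) (w : Equiv.Perm (Fin k)) : Mat k k :=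
  fun i j => if i = w j then 1 else 0

/-- invertible upper triangular matrices -/
def Bp (k : ℕ) : Set (Mat k k) := {M | IsUnit M ∧ ∀ i j : Fin k, j < i → M i j = 0}

/-- invertible lower triangular matrices -/
def Bm (k : ℕ) : Set (Mat k k) := {M | IsUnit M ∧ ∀ i j : Fin k, i < j → M i j = 0}

def dcPlus {k l : ℕ} (w : Mat k l) : Set (Mat k l) :=
  {x | ∃ b ∈ Bp k, ∃ b' ∈ Bp l, x = b * w * b'}

def dcMinus {k l : ℕ} (w : Mat k l) : Set (Mat k l) :=
  {x | ∃ b ∈ Bm k, ∃ b' ∈ Bm l, x = b * w * b'}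

/-- comparison of finsets: sorted lists compare termwise -/
def finsetLE {k : ℕ} (A B : Finset (Fin k)) : Prop :=
  List.Forall₂ (· ≤ ·) (A.sort (· ≤ ·)) (B.sort (· ≤ ·))

/-- Bruhat order on S_k -/
def bruhatLE {k : ℕ} (y z : Equiv.Perm (Fin k)) : Prop :=
  ∀ p : Fin k, finsetLE ((Finset.Iic p).image y) ((Finset.Iic p).image z)

/-- Zariski closure in the space of k×l matrices -/
def zClosure {k l : ℕ} (S : Set (Mat k l)) : Set (Mat k l) :=
  {x | ∀ p : MvPolynomial (Fin k × Fin l) ℂ,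
      (∀ y ∈ S, MvPolynomial.eval (fun q => y q.1 q.2) p = 0) →
      MvPolynomial.eval (fun q => x q.1 q.2) p = 0}

def revP (k : ℕ) : Equiv.Perm (Fin k) := ⟨Fin.rev, Fin.rev, Fin.rev_rev, Fin.rev_rev⟩

def fe (m n : ℕ) : Fin n ⊕ Fin m ≃ Fin (m + n) :=
  finSumFinEquiv.trans (finCongr (Nat.add_comm n m))

/-- the block matrix [[w∘ⁿ, 0],[x, w∘ᵐ]] -/
def embMat (m n : ℕ) (x : Mat m n) : Mat (m+n) (m+n) :=
  Matrix.reindex (fe m n) (fe m n)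
    (Matrix.fromBlocks (permMat n (revP n)) 0 x (permMat m (revP m)))

/-- the permutation (w∘ⁿ,w∘ᵐ) ∈ S_{m+n} -/
def wnmPerm (m n : ℕ) : Equiv.Perm (Fin (m+n)) :=
  ((fe m n).symm.trans (Equiv.sumCongr (revP n) (revP m))).trans (fe m n)

def Pset (m n : ℕ) (w : Equiv.Perm (Fin (m+n))) : Set (Mat m n) :=
  {x | embMat m n x ∈ dcPlus (permMat (m+n) w)}

/-- the matrix with t×t identity in upper-left corner, zeros elsewhere -/
def Imn (m n t : ℕ) : Mat m n := fun i j => if (i:ℕ) = (j:ℕ) ∧ (i:ℕ) < t then 1 else 0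

/-- diagonal matrix with first t diagonal entries 0 and the rest 1 -/
def Jk (k t : ℕ) : Mat k k := fun i j => if (i:ℕ) = (j:ℕ) ∧ t ≤ (i:ℕ) then 1 else 0

noncomputable def subRank {k l : ℕ} (x : Mat k l) (R : Finset (Fin k)) (C : Finset (Fin l)) : ℕ :=
  (x.submatrix (fun i : {a // a ∈ R} => i.1) (fun j : {a // a ∈ C} => j.1)).rank

/-- v(1) < ⋯ < v(t) -/
def headMono {k : ℕ} (t : ℕ) (v : Equiv.Perm (Fin k)) : Prop :=
  ∀ i j : Fin k, i < j → (j:ℕ) < t → v i < v j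

/-- u(t+1) < ⋯ < u(k) -/
def tailMono {k : ℕ} (t : ℕ) (u : Equiv.Perm (Fin k)) : Prop :=
  ∀ i j : Fin k, i < j → t ≤ (i:ℕ) → u i < u j

def embPerm {k t : ℕ} (h : t ≤ k) (τ : Equiv.Perm (Fin t)) : Equiv.Perm (Fin k) :=
  τ.viaFintypeEmbedding (Fin.castLEEmb h)

lemma permMat_mul_apply {k : ℕ} (w : Equiv.Perm (Fin k)) (M : Mat k k) (i j : Fin k) :
    (permMat k w * M) i j = M (w.symm i) j := by
  rw [Matrix.mul_apply, Finset.sum_eq_single (w.symm i)]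
  · simp [permMat]
  · intro b _ hb
    have : i ≠ w b := fun h => hb (by simp [h])
    simp [permMat, this]
  · simp

lemma mul_permMat_apply {k : ℕ} (w : Equiv.Perm (Fin k)) (M : Mat k k) (i j : Fin k) :
    (M * permMat k w) i j = M i (w j) := by
  rw [Matrix.mul_apply, Finset.sum_eq_single (w j)]
  · simp [permMat]
  · intro b _ hb
    simp [permMat, hb]
  · simp

lemma permMat_one (k : ℕ) : permMat k 1 = 1 := by
  ext i j; by_cases h : i = j <;> simp [permMat, Matrix.one_apply, h]

lemma permMat_mul {k : ℕ} (w v : Equiv.Perm (Fin k)) :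
    permMat k (w * v) = permMat k w * permMat k v := by
  ext i j; rw [mul_permMat_apply]; by_cases h : i = w (v j) <;> simp [permMat, h]

lemma permMat_isUnit {k : ℕ} (w : Equiv.Perm (Fin k)) : IsUnit (permMat k w) := by
  refine IsUnit.of_mul_eq_one (permMat k w⁻¹) ?_
  rw [← permMat_mul, mul_inv_cancel, permMat_one]

lemma permMat_mul_transvection {k : ℕ} (w : Equiv.Perm (Fin k)) (a b : Fin k) (t : ℂ) :
    permMat k w * transvection a b t = transvection (w a) (w b) t * permMat k w := by
  ext i j
  rw [permMat_mul_apply, mul_permMat_apply]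
  simp [transvection, Matrix.one_apply, Matrix.single_apply, Equiv.eq_symm_apply, Equiv.symm_apply_eq]

lemma transvection_isUnit {k : ℕ} {a b : Fin k} (h : a ≠ b) (t : ℂ) :
    IsUnit (transvection a b t : Mat k k) := by
  rw [Matrix.isUnit_iff_isUnit_det, det_transvection_of_ne _ _ h]; exact isUnit_one

lemma transvection_mem_Bp {k : ℕ} {a b : Fin k} (h : a < b) (t : ℂ) :
    (transvection a b t : Mat k k) ∈ Bp k := by
  refine ⟨transvection_isUnit h.ne t, fun i j hij => ?_⟩
  have : ¬ (a = i ∧ b = j) := by rintro ⟨rfl, rfl⟩; exact absurd h hij.asymm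
  simp [transvection, Matrix.one_apply, Matrix.single_apply, hij.ne', this]

lemma transvection_mem_Bm {k : ℕ} {a b : Fin k} (h : b < a) (t : ℂ) :
    (transvection a b t : Mat k k) ∈ Bm k := by
  refine ⟨transvection_isUnit h.ne' t, fun i j hij => ?_⟩
  have : ¬ (a = i ∧ b = j) := by rintro ⟨rfl, rfl⟩; exact absurd h hij.asymm
  simp [transvection, Matrix.one_apply, Matrix.single_apply, hij.ne, this]

lemma Bp_mul {k : ℕ} {M M' : Mat k k} (h : M ∈ Bp k) (h' : M' ∈ Bp k) : M * M' ∈ Bp k := by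
  refine ⟨h.1.mul h'.1, ?_⟩
  have : BlockTriangular (M * M') id :=
    BlockTriangular.mul (fun i j hij => h.2 i j hij) (fun i j hij => h'.2 i j hij)
  exact fun i j hij => this hij

lemma Bm_mul {k : ℕ} {M M' : Mat k k} (h : M ∈ Bm k) (h' : M' ∈ Bm k) : M * M' ∈ Bm k := by
  refine ⟨h.1.mul h'.1, ?_⟩
  have : BlockTriangular (M * M') OrderDual.toDual :=
    BlockTriangular.mul (fun i j hij => h.2 i j hij) (fun i j hij => h'.2 i j hij)
  exact fun i j hij => this hij

lemma Bp_inv {k : ℕ} {M : Mat k k} (h : M ∈ Bp k) : M⁻¹ ∈ Bp k := by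
  refine ⟨(Matrix.isUnit_nonsing_inv_iff).2 h.1, ?_⟩
  have ht : BlockTriangular M id := fun i j hij => h.2 i j hij
  have := h.1.invertible
  have h2 := blockTriangular_inv_of_blockTriangular ht
  exact fun i j hij => h2 hij

lemma Bp_diag {k : ℕ} {M : Mat k k} (h : M ∈ Bp k) (i : Fin k) : M i i ≠ 0 := by
  have : BlockTriangular M id := fun i j hij => h.2 i j hij
  have h2 := (Matrix.isUnit_iff_isUnit_det _).1 h.1
  rw [det_of_isUpperTriangular this] at h2
  exact Finset.prod_ne_zero_iff.1 h2.ne_zero i (Finset.mem_univ _)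

lemma Bm_diag {k : ℕ} {M : Mat k k} (h : M ∈ Bm k) (i : Fin k) : M i i ≠ 0 := by
  have : BlockTriangular M OrderDual.toDual := fun i j hij => h.2 i j hij
  have h2 := (Matrix.isUnit_iff_isUnit_det _).1 h.1
  rw [det_of_isLowerTriangular _ this] at h2
  exact Finset.prod_ne_zero_iff.1 h2.ne_zero i (Finset.mem_univ _)

lemma Bp_of_diag {k : ℕ} {M : Mat k k} (h : ∀ i j : Fin k, j < i → M i j = 0)
    (hd : ∀ i, M i i ≠ 0) : M ∈ Bp k := by
  refine ⟨?_, h⟩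
  have : BlockTriangular M id := fun i j hij => h i j hij
  rw [Matrix.isUnit_iff_isUnit_det, det_of_isUpperTriangular this]
  exact (Finset.prod_ne_zero_iff.2 fun i _ => hd i).isUnit

lemma dcPlus_mul_right {k : ℕ} {w x b : Mat k k} (h : x ∈ dcPlus w) (hb : b ∈ Bp k) :
    x * b ∈ dcPlus w := by
  obtain ⟨c, hc, d, hd, rfl⟩ := h
  exact ⟨c, hc, d * b, Bp_mul hd hb, by simp only [Matrix.mul_assoc]⟩

/-- rank one step: an almost upper triangular matrix lies in `B s B`. -/
lemma key {k : ℕ} (a b : Fin k) (hab : (b : ℕ) = a + 1) (c : Mat k k) (hc : IsUnit c)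
    (h0 : c b a ≠ 0) (hz : ∀ i j, j < i → ¬ (i = b ∧ j = a) → c i j = 0) :
    ∃ α : ℂ, ∃ d ∈ Bp k, c = transvection a b α * permMat k (Equiv.swap a b) * d := by
  have hne : a ≠ b := by intro h; rw [h] at hab; omega
  refine ⟨c a a / c b a, permMat k (Equiv.swap a b) * (transvection a b (-(c a a / c b a)) * c),
    ⟨(permMat_isUnit _).mul ((transvection_isUnit hne _).mul hc), ?_⟩, ?_⟩
  · intro i j hij
    rw [permMat_mul_apply, Equiv.symm_swap]
    by_cases hia : i = a
    · subst hia
      rw [Equiv.swap_apply_left, transvection_mul_apply_of_ne _ _ _ _ hne.symm]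
      exact hz _ _ (by rw [Fin.lt_def] at *; omega) (by rintro ⟨-, rfl⟩; exact lt_irrefl _ hij)
    by_cases hib : i = b
    · subst hib
      rw [Equiv.swap_apply_right, transvection_mul_apply_same]
      by_cases hja : j = a
      · subst hja; field_simp; ring
      · have : j < a := by
          rw [Fin.lt_def] at *
          have : (j : ℕ) ≠ a := fun h => hja (Fin.ext h)
          omega
        rw [hz a j this (by tauto), hz i j hij (by tauto)]; ring
    · rw [Equiv.swap_apply_of_ne_of_ne hia hib, transvection_mul_apply_of_ne _ _ _ _ hia]
      exact hz _ _ hij (by tauto)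
  · have h1 : permMat k (Equiv.swap a b) * permMat k (Equiv.swap a b) = 1 := by
      rw [← permMat_mul, Equiv.swap_mul_self, permMat_one]
    have h2 : (transvection a b (c a a / c b a) : Mat k k) * transvection a b (-(c a a / c b a)) = 1 := by
      rw [transvection_mul_transvection_same _ _ hne]; simp
    calc c = transvection a b (c a a / c b a) * transvection a b (-(c a a / c b a)) * c := by
            rw [h2, one_mul]
      _ = transvection a b (c a a / c b a) * (permMat k (Equiv.swap a b) * permMat k (Equiv.swap a b))
            * (transvection a b (-(c a a / c b a)) * c) := by
            rw [h1, mul_one, Matrix.mul_assoc]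
      _ = _ := by simp only [Matrix.mul_assoc]

/-- `ws c ∈ B w B` for `c` almost upper triangular, when `w a > w b`. -/
lemma step_dc {k : ℕ} (a b : Fin k) (hab : (b : ℕ) = a + 1) (w : Equiv.Perm (Fin k))
    (hw : w b < w a) (M c : Mat k k) (hc : IsUnit c)
    (h0 : c b a ≠ 0) (hz : ∀ i j, j < i → ¬ (i = b ∧ j = a) → c i j = 0)
    (hM : M ∈ Bp k) : M * permMat k (w * Equiv.swap a b) * c ∈ dcPlus (permMat k w) := by
  obtain ⟨α, d, hd, rfl⟩ := key a b hab c hc h0 hz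
  refine ⟨M * transvection (w b) (w a) α, Bp_mul hM (transvection_mem_Bp hw α), d, hd, ?_⟩
  have h1 := permMat_mul_transvection (w * Equiv.swap a b) a b α
  have h3 : permMat k w = permMat k (w * Equiv.swap a b) * permMat k (Equiv.swap a b) := by
    rw [← permMat_mul, mul_assoc, Equiv.swap_mul_self, mul_one]
  simp only [Equiv.Perm.mul_apply, Equiv.swap_apply_left, Equiv.swap_apply_right] at h1
  rw [h3]
  simp only [← Matrix.mul_assoc]
  rw [Matrix.mul_assoc M _ (transvection a b α), h1]
  simp only [Matrix.mul_assoc]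

def cnt {k : ℕ} (w : Equiv.Perm (Fin k)) (i p : ℕ) : ℕ :=
  (Finset.univ.filter fun c : Fin k => (c : ℕ) < p ∧ i ≤ (w c : ℕ)).card

lemma cnt_succ {k : ℕ} (w : Equiv.Perm (Fin k)) (i : ℕ) (a : Fin k) :
    cnt w i (a + 1) = cnt w i a + if i ≤ (w a : ℕ) then 1 else 0 := by
  unfold cnt
  split_ifs with h
  · rw [← Finset.card_insert_of_notMem (a := a) (by simp)]
    congr 1
    ext c
    simp only [Finset.mem_insert, Finset.mem_filter, Finset.mem_univ, true_and, Fin.ext_iff]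
    constructor
    · intro hc
      by_cases h' : (c : ℕ) = a
      · exact Or.inl h'
      · exact Or.inr ⟨by omega, hc.2⟩
    · rintro (hc | hc)
      · have := Fin.ext hc; subst this; exact ⟨by omega, h⟩
      · exact ⟨by omega, hc.2⟩
  · rw [add_zero]
    congr 1
    ext c
    simp only [Finset.mem_filter, Finset.mem_univ, true_and]
    constructor
    · intro hc
      refine ⟨?_, hc.2⟩
      have : (c : ℕ) ≠ a := fun h' => by
        have := Fin.ext h'; subst this; exact h hc.2
      omega
    · intro hc; exact ⟨by omega, hc.2⟩

lemma cnt_swap_of_ne {k : ℕ} (w : Equiv.Perm (Fin k)) (a b : Fin k) (hab : (b : ℕ) = a + 1)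
    (i p : ℕ) (hp : p ≠ b) : cnt (w * Equiv.swap a b) i p = cnt w i p := by
  unfold cnt
  refine Finset.card_bij (fun c _ => Equiv.swap a b c) ?_ (fun _ _ _ _ h => by simpa using h) ?_
  · intro c hc
    obtain ⟨-, h1, h2⟩ := Finset.mem_filter.1 hc
    refine Finset.mem_filter.2 ⟨Finset.mem_univ _, ?_, h2⟩
    rcases eq_or_ne c a with rfl | hca
    · rw [Equiv.swap_apply_left]; omega
    rcases eq_or_ne c b with rfl | hcb
    · rw [Equiv.swap_apply_right]; omega
    · rwa [Equiv.swap_apply_of_ne_of_ne hca hcb]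
  · intro c hc
    obtain ⟨-, h1, h2⟩ := Finset.mem_filter.1 hc
    refine ⟨Equiv.swap a b c, Finset.mem_filter.2 ⟨Finset.mem_univ _, ?_, by simpa using h2⟩, by simp⟩
    rcases eq_or_ne c a with rfl | hca
    · rw [Equiv.swap_apply_left]; omega
    rcases eq_or_ne c b with rfl | hcb
    · rw [Equiv.swap_apply_right]; omega
    · rwa [Equiv.swap_apply_of_ne_of_ne hca hcb]

/-- lifting property -/
lemma lifting {k : ℕ} (w y y' : Equiv.Perm (Fin k)) (a b : Fin k) (hab : (b : ℕ) = a + 1)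
    (hw : w b < w a) (hy' : y' a < y' b) (hyy : y = y' ∨ y = y' * Equiv.swap a b)
    (h : ∀ i p, cnt y i p ≤ cnt w i p) (i p : ℕ) :
    cnt y' i p ≤ cnt (w * Equiv.swap a b) i p := by
  have hE : ∀ p : ℕ, p ≠ b → cnt y' i p = cnt y i p := by
    intro p hp
    rcases hyy with rfl | rfl
    · rfl
    · rw [cnt_swap_of_ne _ _ _ hab _ _ hp]
  by_cases hp : p = b
  · subst hp
    have e1 := cnt_succ (w * Equiv.swap a b) i a
    have e2 := cnt_succ (w * Equiv.swap a b) i b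
    have e3 := cnt_succ y' i a
    have e4 := cnt_succ y' i b
    have f1 := cnt_succ w i a
    have f2 := cnt_succ w i b
    rw [cnt_swap_of_ne _ _ _ hab _ a (by omega)] at e1
    rw [cnt_swap_of_ne _ _ _ hab _ (b + 1) (by omega)] at e2
    simp only [Equiv.Perm.mul_apply, Equiv.swap_apply_left, Equiv.swap_apply_right] at e1 e2
    have g1 := h i a
    have g2 := h i (b + 1)
    rw [← hE _ (by omega)] at g1 g2
    rw [Fin.lt_def] at hw hy'
    rw [← hab] at e1 e3 f1
    split_ifs at * <;> omega
  · rw [cnt_swap_of_ne _ _ _ hab _ _ hp, hE p hp]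
    exact h i p

lemma perm_eq_one_of_le {k : ℕ} (y : Equiv.Perm (Fin k)) (h : ∀ c, y c ≤ c) : y = 1 := by
  ext c
  have hs : ∑ c, (y c : ℕ) = ∑ c : Fin k, (c : ℕ) := Equiv.sum_comp y (fun c : Fin k => (c : ℕ))
  have := (Finset.sum_eq_sum_iff_of_le (f := fun c => (y c : ℕ)) (g := fun c => (c : ℕ)) (fun c _ => h c)).1 hs c (Finset.mem_univ _)
  simpa using this

lemma exists_descent {k : ℕ} (w : Equiv.Perm (Fin k)) (hw : w ≠ 1) :
    ∃ a b : Fin k, (b : ℕ) = a + 1 ∧ w b < w a := by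
  by_contra hcon
  push Not at hcon
  apply hw
  have hm : StrictMono w := by
    cases k with
    | zero => intro a; exact a.elim0
    | succ k =>
      rw [Fin.strictMono_iff_lt_succ]
      intro i
      refine lt_of_le_of_ne (hcon i.castSucc i.succ (by simp)) ?_
      intro h
      have := w.injective h
      rw [Fin.ext_iff] at this
      simp at this
  rw [← inv_eq_one]
  apply perm_eq_one_of_le
  intro c
  simpa using hm.le_apply (x := w⁻¹ c)

def mu {k : ℕ} (w : Equiv.Perm (Fin k)) : ℕ := ∑ c : Fin k, (k - (c : ℕ)) * (w c : ℕ)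

lemma mu_swap {k : ℕ} (w : Equiv.Perm (Fin k)) (a b : Fin k) (hab : (b : ℕ) = a + 1)
    (hw : w b < w a) : mu (w * Equiv.swap a b) < mu w := by
  unfold mu
  have hne : a ≠ b := by intro h; rw [h] at hab; omega
  have hb : b ∈ Finset.univ.erase a := by simp [hne.symm]
  rw [← Finset.add_sum_erase _ _ (Finset.mem_univ a), ← Finset.add_sum_erase _ _ hb,
    ← Finset.add_sum_erase (a := a) _ _ (Finset.mem_univ a), ← Finset.add_sum_erase (a := b) _ _ hb]
  have : ∑ x ∈ (Finset.univ.erase a).erase b, (k - (x : ℕ)) * (((w * Equiv.swap a b) x : Fin k) : ℕ)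
      = ∑ x ∈ (Finset.univ.erase a).erase b, (k - (x : ℕ)) * ((w x : Fin k) : ℕ) := by
    refine Finset.sum_congr rfl fun x hx => ?_
    simp only [Finset.mem_erase, Finset.mem_univ, and_true] at hx
    rw [Equiv.Perm.mul_apply, Equiv.swap_apply_of_ne_of_ne hx.2 hx.1]
  rw [this]
  simp only [Equiv.Perm.mul_apply, Equiv.swap_apply_left, Equiv.swap_apply_right]
  have hbk := b.2
  obtain ⟨q, hq⟩ : ∃ q, k - (b : ℕ) = q := ⟨_, rfl⟩
  have hq' : k - (a : ℕ) = q + 1 := by omega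
  rw [hq, hq']
  rw [Fin.lt_def] at hw
  nlinarith

/-- nonemptiness of open Richardson varieties -/
lemma richardson {k : ℕ} : ∀ (r : ℕ) (w y : Equiv.Perm (Fin k)), mu w = r →
    (∀ i p, cnt y i p ≤ cnt w i p) →
    ∃ L ∈ Bm k, L * permMat k y ∈ dcPlus (permMat k w) := by
  intro r
  induction r using Nat.strong_induction_on with
  | _ r ih =>
  intro w y hr h
  by_cases hw1 : w = 1
  · subst hw1
    have hy : y = 1 := by
      apply perm_eq_one_of_le
      intro c
      by_contra hc
      have h1 := h (c + 1) (c + 1)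
      have h2 : cnt (1 : Equiv.Perm (Fin k)) (c + 1) (c + 1) = 0 := by
        unfold cnt
        rw [Finset.card_eq_zero, Finset.filter_eq_empty_iff]
        intro x _ hx
        simp only [Equiv.Perm.one_apply] at hx
        omega
      have h3 : 0 < cnt y (c + 1) (c + 1) := by
        unfold cnt
        rw [Finset.card_pos]
        refine ⟨c, Finset.mem_filter.2 ⟨Finset.mem_univ _, by omega, ?_⟩⟩
        have := not_le.1 hc
        rw [Fin.lt_def] at this
        omega
      omega
    subst hy
    have hone : (1 : Mat k k) ∈ Bp k := ⟨isUnit_one, fun i j hij => Matrix.one_apply_ne hij.ne'⟩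
    refine ⟨1, ⟨isUnit_one, fun i j hij => Matrix.one_apply_ne hij.ne⟩, 1, hone, 1, hone, ?_⟩
    simp
  · obtain ⟨a, b, hab, hd⟩ := exists_descent w hw1
    have hne : a ≠ b := by intro h; rw [h] at hab; omega
    have hlt : a < b := by rw [Fin.lt_def]; omega
    have hmu := mu_swap w a b hab hd
    rcases lt_or_gt_of_ne (fun h => hne (y.injective h) : y a ≠ y b) with hy | hy
    · obtain ⟨L, hL, M, hM, d, hdd, he⟩ := ih _ (hr ▸ hmu) (w * Equiv.swap a b) y rfl
        (lifting w y y a b hab hd hy (Or.inl rfl) h)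
      refine ⟨L * transvection (y b) (y a) 1, Bm_mul hL (transvection_mem_Bm hy 1), ?_⟩
      have e : L * transvection (y b) (y a) 1 * permMat k y =
          M * permMat k (w * Equiv.swap a b) * (d * transvection b a 1) := by
        rw [Matrix.mul_assoc, ← permMat_mul_transvection, ← Matrix.mul_assoc, he]
        simp only [Matrix.mul_assoc]
      rw [e]
      refine step_dc a b hab w hd M _ (hdd.1.mul (transvection_isUnit hne.symm 1)) ?_ ?_ hM
      · rw [mul_transvection_apply_same, hdd.2 _ _ hlt]
        simpa using Bp_diag hdd b
      · intro i j hij hn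
        by_cases hja : j = a
        · subst hja
          have : b < i := by
            have : i ≠ b := by tauto
            rw [Fin.lt_def] at *
            have : (i : ℕ) ≠ b := fun h => this (Fin.ext h)
            omega
          rw [mul_transvection_apply_same, hdd.2 _ _ hij, hdd.2 _ _ this]; simp
        · rw [mul_transvection_apply_of_ne _ _ _ _ hja]; exact hdd.2 _ _ hij
    · obtain ⟨L, hL, M, hM, d, hdd, he⟩ := ih _ (hr ▸ hmu) (w * Equiv.swap a b)
        (y * Equiv.swap a b) rfl
        (lifting w y (y * Equiv.swap a b) a b hab hd
          (by simpa using hy) (Or.inr (by rw [mul_assoc, Equiv.swap_mul_self, mul_one])) h)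
      refine ⟨L, hL, ?_⟩
      have e : L * permMat k y =
          M * permMat k (w * Equiv.swap a b) * (d * permMat k (Equiv.swap a b)) := by
        rw [← Matrix.mul_assoc, ← he, Matrix.mul_assoc, ← permMat_mul, mul_assoc,
          Equiv.swap_mul_self, mul_one]
      rw [e]
      refine step_dc a b hab w hd M _ (hdd.1.mul (permMat_isUnit _)) ?_ ?_ hM
      · rw [mul_permMat_apply, Equiv.swap_apply_left]
        exact Bp_diag hdd b
      · intro i j hij hn
        rw [mul_permMat_apply]
        refine hdd.2 _ _ ?_
        rcases eq_or_ne j a with rfl | hja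
        · rw [Equiv.swap_apply_left]
          have : i ≠ b := by tauto
          rw [Fin.lt_def] at *
          have : (i : ℕ) ≠ b := fun h => this (Fin.ext h)
          omega
        rcases eq_or_ne j b with rfl | hjb
        · rw [Equiv.swap_apply_right]; exact hlt.trans hij
        · rwa [Equiv.swap_apply_of_ne_of_ne hja hjb]

/-- Bruhat decomposition, uniqueness -/
lemma bruhat_le_of_mem {k : ℕ} (M : Mat k k) (w v : Equiv.Perm (Fin k))
    (hw : M ∈ dcPlus (permMat k w)) (hv : M ∈ dcPlus (permMat k v)) (j : Fin k) : w j ≤ v j := by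
  obtain ⟨b, hb, b', hb', rfl⟩ := hw
  obtain ⟨c, hc, c', hc', he⟩ := hv
  have u1 := (Matrix.isUnit_iff_isUnit_det _).1 hb.1
  have u2 := (Matrix.isUnit_iff_isUnit_det _).1 hc'.1
  have e : permMat k w * (b' * c'⁻¹) = (b⁻¹ * c) * permMat k v := by
    have := congrArg (fun X => b⁻¹ * X * c'⁻¹) he
    try simp only at this
    rw [Matrix.mul_assoc b, Matrix.nonsing_inv_mul_cancel_left _ _ u1, ← Matrix.mul_assoc b⁻¹,
      Matrix.mul_nonsing_inv_cancel_right _ _ u2] at this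
    rw [← Matrix.mul_assoc, this, Matrix.mul_assoc]
  have e2 := congrFun (congrFun e (w j)) j
  rw [permMat_mul_apply, mul_permMat_apply, Equiv.symm_apply_apply] at e2
  by_contra hcon
  rw [(Bp_mul (Bp_inv hb) hc).2 _ _ (not_le.1 hcon)] at e2
  exact Bp_diag (Bp_mul hb' (Bp_inv hc')) j e2

lemma bruhat_unique {k : ℕ} (M : Mat k k) (w v : Equiv.Perm (Fin k))
    (hw : M ∈ dcPlus (permMat k w)) (hv : M ∈ dcPlus (permMat k v)) : w = v :=
  Equiv.ext fun j => le_antisymm (bruhat_le_of_mem M w v hw hv j) (bruhat_le_of_mem M v w hv hw j)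

/-- Bruhat decomposition, existence -/
lemma bruhat_exists {k : ℕ} (M : Mat k k) (hM : IsUnit M) :
    ∃ w : Equiv.Perm (Fin k), M ∈ dcPlus (permMat k w) := by
  let Good : Fin k → Fin k → (Fin k → ℂ) → Prop := fun j i v =>
    v j = 1 ∧ (∀ l, j < l → v l = 0) ∧ ∀ l, i < l → (M *ᵥ v) l = 0
  have hex : ∀ j : Fin k, ∃ i : Fin k, (∃ v, Good j i v) ∧ ∀ i' < i, ¬ ∃ v, Good j i' v := by
    intro j
    have hne : ∃ i, ∃ v, Good j i v := by
      refine ⟨⟨k - 1, by have := j.2; omega⟩, Pi.single j 1, by simp, ?_, ?_⟩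
      · intro l hl; simp [hl.ne']
      · intro l hl
        rw [Fin.lt_def] at hl
        simp only at hl
        have := l.2
        omega
    obtain ⟨i, hi, hmin⟩ := WellFounded.has_min (wellFounded_lt (α := Fin k))
      {i | ∃ v, Good j i v} hne
    exact ⟨i, hi, fun i' h h' => hmin i' h' h⟩
  choose w hw hmin using hex
  choose v hv using hw
  have hnz : ∀ j, (M *ᵥ v j) (w j) ≠ 0 := by
    intro j h0
    by_cases hw0 : (w j : ℕ) = 0
    · have hz : M *ᵥ v j = 0 := by
        ext l
        rcases eq_or_ne l (w j) with rfl | hl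
        · exact h0
        · refine (hv j).2.2 l ?_
          rw [Fin.lt_def]
          have : (l : ℕ) ≠ w j := fun h => hl (Fin.ext h)
          omega
      have hinj := Matrix.mulVec_injective_of_isUnit hM
      have : v j = 0 := hinj (by rw [hz, Matrix.mulVec_zero])
      have h1 := (hv j).1
      rw [this] at h1
      simp at h1
    · refine hmin j ⟨(w j : ℕ) - 1, by omega⟩ (by rw [Fin.lt_def]; simp only; omega)
        ⟨v j, (hv j).1, (hv j).2.1, ?_⟩
      intro l hl
      rcases eq_or_ne l (w j) with rfl | hl'
      · exact h0
      · refine (hv j).2.2 l ?_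
        rw [Fin.lt_def] at *
        have : (l : ℕ) ≠ w j := fun h => hl' (Fin.ext h)
        simp only at hl
        omega
  have hlt : ∀ j j', j' < j → w j' ≠ w j := by
    intro j j' hj hww
    set t : ℂ := (M *ᵥ v j) (w j) / (M *ᵥ v j') (w j) with ht
    have hnz' := hnz j'
    rw [hww] at hnz'
    have hu1 : (v j - t • v j') j = 1 := by
      simp [(hv j).1, (hv j').2.1 j hj]
    have hu2 : ∀ l, j < l → (v j - t • v j') l = 0 := by
      intro l hl
      simp [(hv j).2.1 l hl, (hv j').2.1 l (hj.trans hl)]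
    have hu3 : ∀ l, w j ≤ l → (M *ᵥ (v j - t • v j')) l = 0 := by
      intro l hl
      rw [Matrix.mulVec_sub, Matrix.mulVec_smul]
      simp only [Pi.sub_apply, Pi.smul_apply, smul_eq_mul]
      rcases hl.eq_or_lt with rfl | hl
      · rw [ht]; field_simp; ring
      · rw [(hv j).2.2 l hl, (hv j').2.2 l (by rw [hww]; exact hl)]; simp
    by_cases hw0 : (w j : ℕ) = 0
    · have hz : M *ᵥ (v j - t • v j') = 0 := by
        ext l
        exact hu3 l (by rw [Fin.le_def]; omega)
      have hinj := Matrix.mulVec_injective_of_isUnit hM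
      have : v j - t • v j' = 0 := hinj (by rw [hz, Matrix.mulVec_zero])
      rw [this] at hu1
      simp at hu1
    · refine hmin j ⟨(w j : ℕ) - 1, by omega⟩ (by rw [Fin.lt_def]; simp only; omega)
        ⟨v j - t • v j', hu1, hu2, ?_⟩
      intro l hl
      refine hu3 l ?_
      rw [Fin.lt_def] at hl
      rw [Fin.le_def]
      simp only at hl
      omega
  have hinj : Function.Injective w := by
    intro j j' h
    by_contra hne
    rcases lt_or_gt_of_ne hne with h' | h'
    · exact hlt _ _ h' h
    · exact hlt _ _ h' h.symm
  let W : Equiv.Perm (Fin k) := Equiv.ofBijective w (Finite.injective_iff_bijective.1 hinj)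
  have hW : ∀ j, W j = w j := fun j => rfl
  let V : Mat k k := fun i j => v j i
  have hV : V ∈ Bp k := Bp_of_diag (fun i j hij => (hv j).2.1 i hij)
    (fun i => by change v i i ≠ 0; rw [(hv i).1]; exact one_ne_zero)
  have hMV : ∀ i j, (M * V) i j = (M *ᵥ v j) i := fun i j => rfl
  have hb : M * V * permMat k W⁻¹ ∈ Bp k := by
    apply Bp_of_diag
    · intro i j hij
      rw [mul_permMat_apply, hMV]
      refine (hv _).2.2 i ?_
      rw [← hW]; simpa using hij
    · intro i
      rw [mul_permMat_apply, hMV]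
      have := hnz (W⁻¹ i)
      rw [← hW] at this
      simpa using this
  refine ⟨W, _, hb, V⁻¹, Bp_inv hV, ?_⟩
  rw [Matrix.mul_assoc (M * V), ← permMat_mul, inv_mul_cancel, permMat_one, mul_one,
    Matrix.mul_nonsing_inv_cancel_right _ _ ((Matrix.isUnit_iff_isUnit_det _).1 hV.1)]

lemma forall₂_countP {k : ℕ} (i : ℕ) {l l' : List (Fin k)} (h : List.Forall₂ (· ≤ ·) l l') :
    l.countP (fun a : Fin k => i ≤ (a : ℕ)) ≤ l'.countP (fun a : Fin k => i ≤ (a : ℕ)) := by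
  induction h with
  | nil => simp
  | @cons a b l l' hab _ ih =>
    rw [List.countP_cons, List.countP_cons]
    rw [Fin.le_def] at hab
    by_cases h1 : i ≤ (a : ℕ)
    · have h2 : i ≤ (b : ℕ) := h1.trans hab
      simp [h1, h2, ih]
    · simp only [h1, decide_false]
      split_ifs <;> first | omega | simp_all

lemma forall₂_of_countP {k : ℕ} : ∀ (l l' : List (Fin k)), l.Pairwise (· ≤ ·) →
    l'.Pairwise (· ≤ ·) → l.length = l'.length →
    (∀ i : ℕ, l.countP (fun a : Fin k => i ≤ (a : ℕ)) ≤ l'.countP (fun a : Fin k => i ≤ (a : ℕ))) →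
    List.Forall₂ (· ≤ ·) l l' := by
  intro l
  induction l with
  | nil =>
    intro l' _ _ hl _
    cases l' with
    | nil => exact List.Forall₂.nil
    | cons b l' => simp at hl
  | cons a l ih =>
    intro l' hs hs' hl hc
    cases l' with
    | nil => simp at hl
    | cons b l' =>
      rw [List.pairwise_cons] at hs hs'
      simp only [List.length_cons, add_left_inj] at hl
      have full : ∀ (c : Fin k) (t : List (Fin k)) (i : ℕ), (∀ x ∈ t, c ≤ x) → i ≤ (c : ℕ) →
          t.countP (fun a : Fin k => i ≤ (a : ℕ)) = t.length := by
        intro c t i ht hi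
        rw [List.countP_eq_length]
        intro x hx
        have := ht x hx
        rw [Fin.le_def] at this
        simp only [decide_eq_true_eq]
        omega
      have hab : a ≤ b := by
        by_contra hab
        rw [not_le, Fin.lt_def] at hab
        have h1 := hc a
        rw [List.countP_cons, List.countP_cons, full a l a hs.1 le_rfl] at h1
        have h2 : ¬ ((a : ℕ) ≤ b) := by omega
        have h3 := List.countP_le_length (p := fun x : Fin k => decide ((a : ℕ) ≤ (x : ℕ))) (l := l')
        simp only [le_refl, decide_true, if_true, h2, decide_false] at h1
        simp only [Bool.false_eq_true, if_false] at h1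
        omega
      refine List.Forall₂.cons hab (ih l' hs.2 hs'.2 hl fun i => ?_)
      rw [Fin.le_def] at hab
      by_cases hib : i ≤ (b : ℕ)
      · rw [full b l' i hs'.1 hib, ← hl]
        exact List.countP_le_length
      · have h1 := hc i
        have hia : ¬ i ≤ (a : ℕ) := by omega
        rw [List.countP_cons, List.countP_cons] at h1
        simpa [hib, hia] using h1

lemma countP_sort {k : ℕ} (w : Equiv.Perm (Fin k)) (p : Fin k) (i : ℕ) :
    (((Finset.Iic p).image w).sort (· ≤ ·)).countP (fun a : Fin k => i ≤ (a : ℕ)) = cnt w i (p + 1) := by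
  have h1 : (((Finset.Iic p).image w).sort (· ≤ ·)).countP (fun a : Fin k => i ≤ (a : ℕ))
      = (((Finset.Iic p).image w).filter (fun a : Fin k => i ≤ (a : ℕ))).card := by
    rw [← Multiset.coe_countP, Finset.sort_eq, Multiset.countP_eq_card_filter]
    simp [Finset.card_def]
  rw [h1, Finset.filter_image, Finset.card_image_of_injective _ w.injective]
  unfold cnt
  congr 1
  ext c
  simp only [Finset.mem_filter, Finset.mem_Iic, Finset.mem_univ, true_and, Fin.le_def]
  rw [Nat.lt_succ_iff]

lemma cnt_big {k : ℕ} (w : Equiv.Perm (Fin k)) (i p : ℕ) (hp : k ≤ p) : cnt w i p = cnt w i k := by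
  unfold cnt
  congr 1
  ext c
  have := c.2
  simp only [Finset.mem_filter, Finset.mem_univ, true_and]
  constructor <;> rintro ⟨_, h⟩ <;> exact ⟨by omega, h⟩

lemma bruhatLE_iff {k : ℕ} (y w : Equiv.Perm (Fin k)) :
    bruhatLE y w ↔ ∀ i p, cnt y i p ≤ cnt w i p := by
  constructor
  · intro h i p
    have key1 : ∀ p : Fin k, cnt y i (p + 1) ≤ cnt w i (p + 1) := by
      intro p
      rw [← countP_sort, ← countP_sort]
      exact forall₂_countP i (h p)
    rcases Nat.eq_zero_or_pos p with rfl | hp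
    · simp [cnt]
    by_cases hk : p ≤ k
    · have := key1 ⟨p - 1, by omega⟩
      simp only at this
      rwa [Nat.sub_add_cancel hp] at this
    · rw [cnt_big y i p (by omega), cnt_big w i p (by omega)]
      rcases Nat.eq_zero_or_pos k with rfl | hk
      · simp [cnt]
      have := key1 ⟨k - 1, by omega⟩
      simp only at this
      rwa [Nat.sub_add_cancel hk] at this
  · intro h p
    refine forall₂_of_countP _ _ (Finset.pairwise_sort _ _) (Finset.pairwise_sort _ _) ?_ ?_
    · rw [Finset.length_sort, Finset.length_sort, Finset.card_image_of_injective _ y.injective,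
        Finset.card_image_of_injective _ w.injective]
    · intro i
      rw [countP_sort, countP_sort]
      exact h _ _

lemma cnt_compl {k : ℕ} (w : Equiv.Perm (Fin k)) (i p : ℕ) :
    cnt w i p + Fintype.card {c : Fin k // (c : ℕ) < p ∧ (w c : ℕ) < i} =
      (Finset.univ.filter fun c : Fin k => (c : ℕ) < p).card := by
  rw [Fintype.card_subtype]
  unfold cnt
  rw [← Finset.filter_filter, ← Finset.filter_filter]
  simp only [← not_le]
  rw [Finset.card_filter_add_card_filter_not]

/-- if `B⁻ y` meets `B w B` then `y ≤ w`. -/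
lemma cnt_le_of_mem {k : ℕ} (y w : Equiv.Perm (Fin k)) (L : Mat k k) (hL : L ∈ Bm k)
    (h : L * permMat k y ∈ dcPlus (permMat k w)) (i p : ℕ) : cnt y i p ≤ cnt w i p := by
  obtain ⟨b, hb, b', hb', he⟩ := h
  have hS := cnt_compl w i p
  have hT := cnt_compl y i p
  suffices Fintype.card {c : Fin k // (c : ℕ) < p ∧ (w c : ℕ) < i} ≤
      Fintype.card {c : Fin k // (c : ℕ) < p ∧ (y c : ℕ) < i} by omega
  have hd := Bp_inv hb'
  have u := (Matrix.isUnit_iff_isUnit_det _).1 hb'.1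
  let A : Matrix {c : Fin k // (c : ℕ) < p ∧ (y c : ℕ) < i}
      {c : Fin k // (c : ℕ) < p ∧ (w c : ℕ) < i} ℂ := fun s t => b'⁻¹ s.1 t.1
  refine card_le_of_injective ℂ (Matrix.mulVecLin A) ?_
  rw [injective_iff_map_eq_zero]
  intro f hf
  let g : Fin k → ℂ := fun c => if hc : (c : ℕ) < p ∧ (w c : ℕ) < i then f ⟨c, hc⟩ else 0
  let v := b'⁻¹ *ᵥ g
  have hsum : ∀ s, v s = ∑ t : {c : Fin k // (c : ℕ) < p ∧ (w c : ℕ) < i}, b'⁻¹ s t.1 * f t := by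
    intro s
    change ∑ t, b'⁻¹ s t * g t = _
    have h1 : ∀ t : {c : Fin k // (c : ℕ) < p ∧ (w c : ℕ) < i}, b'⁻¹ s t.1 * f t =
        b'⁻¹ s t.1 * g t.1 := by
      intro t
      simp only [g, dif_pos t.2]
    rw [Finset.sum_congr rfl fun t _ => h1 t,
      ← Finset.sum_subtype (Finset.univ.filter fun c : Fin k => (c : ℕ) < p ∧ (w c : ℕ) < i)
        (by simp) (fun t => b'⁻¹ s t * g t), Finset.sum_filter]
    refine Finset.sum_congr rfl fun t _ => ?_
    split_ifs with ht
    · rfl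
    · simp only [g, dif_neg ht, mul_zero]
  have hv1 : ∀ s : Fin k, (s : ℕ) < p → (y s : ℕ) < i → v s = 0 := by
    intro s h1 h2
    rw [hsum]
    exact congrFun hf ⟨s, h1, h2⟩
  have hv2 : ∀ s : Fin k, p ≤ (s : ℕ) → v s = 0 := by
    intro s h1
    rw [hsum]
    refine Finset.sum_eq_zero fun t _ => ?_
    rw [hd.2 s t.1 (by rw [Fin.lt_def]; have := t.2.1; omega), zero_mul]
  have hM1 : ∀ r : Fin k, (r : ℕ) < i → ((L * permMat k y) *ᵥ v) r = 0 := by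
    intro r hr
    change ∑ c, (L * permMat k y) r c * v c = 0
    refine Finset.sum_eq_zero fun c _ => ?_
    rw [mul_permMat_apply]
    by_cases h1 : (y c : ℕ) < i
    · by_cases h2 : (c : ℕ) < p
      · rw [hv1 c h2 h1, mul_zero]
      · rw [hv2 c (by omega), mul_zero]
    · rw [hL.2 _ _ (by rw [Fin.lt_def]; omega), zero_mul]
  have hM2 : ∀ r : Fin k, i ≤ (r : ℕ) → ((L * permMat k y) *ᵥ v) r = 0 := by
    intro r hr
    rw [he, Matrix.mulVec_mulVec, Matrix.mul_nonsing_inv_cancel_right _ _ u]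
    change ∑ c, (b * permMat k w) r c * g c = 0
    refine Finset.sum_eq_zero fun c _ => ?_
    rw [mul_permMat_apply]
    by_cases h1 : (c : ℕ) < p ∧ (w c : ℕ) < i
    · rw [hb.2 _ _ (by rw [Fin.lt_def]; omega), zero_mul]
    · simp only [g, dif_neg h1, mul_zero]
  have hMv : (L * permMat k y) *ᵥ v = 0 := by
    ext r
    rcases lt_or_ge (r : ℕ) i with hr | hr
    · exact hM1 r hr
    · exact hM2 r hr
  have hv0 : v = 0 := Matrix.mulVec_injective_of_isUnit (hL.1.mul (permMat_isUnit y))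
    (by rw [hMv, Matrix.mulVec_zero])
  have hg : g = 0 := Matrix.mulVec_injective_of_isUnit hd.1
    (by rw [Matrix.mulVec_zero]; exact hv0)
  ext t
  have := congrFun hg t.1
  simp only [g, dif_pos t.2] at this
  exact this

lemma fe_inl (m n : ℕ) (a : Fin n) : (fe m n (Sum.inl a) : ℕ) = a := by
  simp [fe]

lemma fe_inr (m n : ℕ) (a : Fin m) : (fe m n (Sum.inr a) : ℕ) = n + a := by
  simp [fe, add_comm]

lemma permMat_wnm (m n : ℕ) : permMat (m + n) (wnmPerm m n) =
    Matrix.reindex (fe m n) (fe m n)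
      (Matrix.fromBlocks (permMat n (revP n)) 0 0 (permMat m (revP m))) := by
  ext i j
  obtain ⟨i, rfl⟩ := (fe m n).surjective i
  obtain ⟨j, rfl⟩ := (fe m n).surjective j
  rcases i with i | i <;> rcases j with j | j <;>
    simp [permMat, wnmPerm]

lemma rev_mul_rev (n : ℕ) : permMat n (revP n) * permMat n (revP n) = 1 := by
  rw [← permMat_mul, ← permMat_one]
  congr 1
  ext i
  simp [revP]

lemma reindex_mul' (m n : ℕ) (A B : Matrix (Fin n ⊕ Fin m) (Fin n ⊕ Fin m) ℂ) :
    Matrix.reindex (fe m n) (fe m n) A * Matrix.reindex (fe m n) (fe m n) B =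
      Matrix.reindex (fe m n) (fe m n) (A * B) := by
  simp [Matrix.reindex_apply, Matrix.submatrix_mul_equiv]

lemma emb_eq (m n : ℕ) (x : Mat m n) : ∃ L ∈ Bm (m + n),
    embMat m n x = L * permMat (m + n) (wnmPerm m n) := by
  refine ⟨Matrix.reindex (fe m n) (fe m n)
    (Matrix.fromBlocks 1 0 (x * permMat n (revP n)) 1), ⟨?_, ?_⟩, ?_⟩
  · rw [Matrix.isUnit_iff_isUnit_det, Matrix.det_reindex_self, Matrix.det_fromBlocks_zero₁₂]
    simp
  · intro i j
    obtain ⟨i, rfl⟩ := (fe m n).surjective i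
    obtain ⟨j, rfl⟩ := (fe m n).surjective j
    rw [Fin.lt_def]
    rcases i with i | i <;> rcases j with j | j <;>
      simp only [fe_inl, fe_inr, Matrix.reindex_apply, Matrix.submatrix_apply,
        Equiv.symm_apply_apply, Matrix.fromBlocks_apply₁₁, Matrix.fromBlocks_apply₁₂,
        Matrix.fromBlocks_apply₂₁, Matrix.fromBlocks_apply₂₂, Matrix.zero_apply,
        implies_true] <;> intro h
    · exact Matrix.one_apply_ne (by rintro rfl; omega)
    · have := j.2; omega
    · exact Matrix.one_apply_ne (by rintro rfl; omega)
  · rw [permMat_wnm, reindex_mul', Matrix.fromBlocks_multiply]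
    simp [embMat, Matrix.mul_assoc, rev_mul_rev]

lemma emb_of_lower (m n : ℕ) (L : Mat (m + n) (m + n)) (hL : L ∈ Bm (m + n)) :
    ∃ x : Mat m n, ∃ β ∈ Bp (m + n),
      embMat m n x = L * permMat (m + n) (wnmPerm m n) * β := by
  let L' := L.submatrix (fe m n) (fe m n)
  let A : Mat n n := L'.toBlocks₁₁
  let C : Mat m n := L'.toBlocks₂₁
  let D : Mat m m := L'.toBlocks₂₂
  have hA0 : ∀ i j : Fin n, i < j → A i j = 0 := fun i j hij =>
    hL.2 _ _ (by rw [Fin.lt_def, fe_inl, fe_inl]; exact hij)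
  have hD0 : ∀ i j : Fin m, i < j → D i j = 0 := fun i j hij =>
    hL.2 _ _ (by rw [Fin.lt_def] at *; rw [fe_inr, fe_inr]; omega)
  have hB0 : L'.toBlocks₁₂ = 0 := by
    ext i j
    exact hL.2 _ _ (by rw [Fin.lt_def, fe_inl, fe_inr]; omega)
  have hL' : L' = Matrix.fromBlocks A 0 C D := by
    rw [← hB0]; exact (Matrix.fromBlocks_toBlocks L').symm
  have hLe : L = Matrix.reindex (fe m n) (fe m n) (Matrix.fromBlocks A 0 C D) := by
    rw [← hL']; ext i j; simp [L']
  have hAd : ∀ i, A i i ≠ 0 := fun i => Bm_diag hL _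
  have hDd : ∀ i, D i i ≠ 0 := fun i => Bm_diag hL _
  have hAu : IsUnit A.det := by
    have : BlockTriangular A OrderDual.toDual := fun i j hij => hA0 i j hij
    rw [det_of_isLowerTriangular _ this]
    exact (Finset.prod_ne_zero_iff.2 fun i _ => hAd i).isUnit
  let β' : Mat (m + n) (m + n) := Matrix.reindex (fe m n) (fe m n)
    (Matrix.fromBlocks (permMat n (revP n) * A * permMat n (revP n)) 0 0
      (permMat m (revP m) * D * permMat m (revP m)))
  have hβ : β' ∈ Bp (m + n) := by
    have hrs : ∀ k (i : Fin k), (revP k).symm i = Fin.rev i := fun k i => rfl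
    have hr : ∀ k (i : Fin k), revP k i = Fin.rev i := fun k i => rfl
    apply Bp_of_diag
    · intro i j
      obtain ⟨i, rfl⟩ := (fe m n).surjective i
      obtain ⟨j, rfl⟩ := (fe m n).surjective j
      rw [Fin.lt_def]
      rcases i with i | i <;> rcases j with j | j <;>
        simp only [β', fe_inl, fe_inr, Matrix.reindex_apply, Matrix.submatrix_apply,
          Equiv.symm_apply_apply, Matrix.fromBlocks_apply₁₁, Matrix.fromBlocks_apply₁₂,
          Matrix.fromBlocks_apply₂₁, Matrix.fromBlocks_apply₂₂, Matrix.zero_apply,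
          implies_true] <;> intro h
      · rw [mul_permMat_apply, permMat_mul_apply, hrs, hr]
        exact hA0 _ _ (Fin.rev_lt_rev.2 h)
      · rw [mul_permMat_apply, permMat_mul_apply, hrs, hr]
        exact hD0 _ _ (Fin.rev_lt_rev.2 (by rw [Fin.lt_def]; omega))
    · intro i
      obtain ⟨i, rfl⟩ := (fe m n).surjective i
      rcases i with i | i <;>
        simp only [β', Matrix.reindex_apply, Matrix.submatrix_apply,
          Equiv.symm_apply_apply, Matrix.fromBlocks_apply₁₁, Matrix.fromBlocks_apply₂₂] <;>
        rw [mul_permMat_apply, permMat_mul_apply, hrs, hr]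
      · exact hAd _
      · exact hDd _
  refine ⟨C * A⁻¹ * permMat n (revP n), β'⁻¹, Bp_inv hβ, ?_⟩
  have hu := (Matrix.isUnit_iff_isUnit_det _).1 hβ.1
  have e : embMat m n (C * A⁻¹ * permMat n (revP n)) * β' =
      L * permMat (m + n) (wnmPerm m n) := by
    rw [hLe, permMat_wnm, reindex_mul']
    unfold embMat
    rw [reindex_mul', Matrix.fromBlocks_multiply, Matrix.fromBlocks_multiply]
    have r1 : ∀ (k l : ℕ) (X : Mat k l), permMat k (revP k) * (permMat k (revP k) * X) = X := by
      intro k l X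
      rw [← Matrix.mul_assoc, rev_mul_rev, Matrix.one_mul]
    simp [Matrix.mul_assoc, r1, Matrix.nonsing_inv_mul_cancel_left _ _ hAu]
  rw [← e, Matrix.mul_nonsing_inv_cancel_right _ _ hu]

theorem statement3 (m n : ℕ) (hm : 0 < m) (hn : 0 < n) :
    (∀ x : Mat m n,
      (∃! w : Equiv.Perm (Fin (m+n)), x ∈ Pset m n w) ∧
      (∀ w : Equiv.Perm (Fin (m+n)), x ∈ Pset m n w → bruhatLE (wnmPerm m n) w)) ∧
    (∀ w : Equiv.Perm (Fin (m+n)), bruhatLE (wnmPerm m n) w → (Pset m n w).Nonempty) := by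
  have hmem : ∀ (x : Mat m n) (w : Equiv.Perm (Fin (m+n))), x ∈ Pset m n w →
      bruhatLE (wnmPerm m n) w := by
    intro x w hx
    obtain ⟨L, hL, he⟩ := emb_eq m n x
    rw [bruhatLE_iff]
    refine cnt_le_of_mem _ _ L hL ?_
    rw [← he]
    exact hx
  refine ⟨fun x => ⟨?_, hmem x⟩, ?_⟩
  · obtain ⟨L, hL, he⟩ := emb_eq m n x
    obtain ⟨w, hw⟩ := bruhat_exists (embMat m n x) (by
      rw [he]; exact hL.1.mul (permMat_isUnit _))
    exact ⟨w, hw, fun v hv => bruhat_unique _ _ _ hv hw⟩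
  · intro w hw
    rw [bruhatLE_iff] at hw
    obtain ⟨L, hL, hm⟩ := richardson _ w (wnmPerm m n) rfl hw
    obtain ⟨x, β, hβ, he⟩ := emb_of_lower m n L hL
    refine ⟨x, ?_⟩
    change embMat m n x ∈ dcPlus (permMat (m+n) w)
    rw [he]
    exact dcPlus_mul_right hm hβ
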